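/- In a free group F, a nontrivial commutator is never a proper power: if V, X, Y ∈ F and V^m = [X,Y] with m ≥ 2, then V = 1 (equivalently [X,Y] = 1). -/

import Mathlib

/-- The discrete Heisenberg group: integral unitriangular `3 × 3` matrices, with `x` and `y` on the
superdiagonal and `z` in the corner. -/
@[ext]
structure IntHeisenberg where
  x : ℤ
  y : ℤ
  z : ℤ

namespace IntHeisenberg

instance : Mul IntHeisenberg := ⟨fun g h => ⟨g.x + h.x, g.y + h.y, g.z + h.z + g.x * h.y⟩⟩

instance : One IntHeisenberg := ⟨⟨0, 0, 0⟩⟩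

instance : Inv IntHeisenberg := ⟨fun g => ⟨-g.x, -g.y, -g.z + g.x * g.y⟩⟩

@[simp] lemma mul_x (g h : IntHeisenberg) : (g * h).x = g.x + h.x := rfl

@[simp] lemma mul_y (g h : IntHeisenberg) : (g * h).y = g.y + h.y := rfl

@[simp] lemma mul_z (g h : IntHeisenberg) : (g * h).z = g.z + h.z + g.x * h.y := rfl

@[simp] lemma one_x : (1 : IntHeisenberg).x = 0 := rfl

@[simp] lemma one_y : (1 : IntHeisenberg).y = 0 := rfl

@[simp] lemma one_z : (1 : IntHeisenberg).z = 0 := rfl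

@[simp] lemma inv_x (g : IntHeisenberg) : g⁻¹.x = -g.x := rfl

@[simp] lemma inv_y (g : IntHeisenberg) : g⁻¹.y = -g.y := rfl

@[simp] lemma inv_z (g : IntHeisenberg) : g⁻¹.z = -g.z + g.x * g.y := rfl

instance : Group IntHeisenberg :=
  Group.ofLeftAxioms
    (fun a b c => by ext <;> simp <;> ring)
    (fun a => by ext <;> simp)
    (fun a => by ext <;> simp)

lemma pow_x (g : IntHeisenberg) (n : ℕ) : (g ^ n).x = n * g.x := by
  induction n with
  | zero => simp
  | succ n ih => rw [pow_succ, mul_x, ih]; push_cast; ring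

lemma pow_y (g : IntHeisenberg) (n : ℕ) : (g ^ n).y = n * g.y := by
  induction n with
  | zero => simp
  | succ n ih => rw [pow_succ, mul_y, ih]; push_cast; ring

lemma pow_z_of_y_eq_zero {g : IntHeisenberg} (hg : g.y = 0) (n : ℕ) : (g ^ n).z = n * g.z := by
  induction n with
  | zero => simp
  | succ n ih => rw [pow_succ, mul_z, ih, hg]; push_cast; ring

/-- The homomorphism `g ↦ s * g.x + t * g.y` to `ZMod m`. -/
def toZMod (m : ℕ) (s t : ℤ) : IntHeisenberg →* Multiplicative (ZMod m) where
  toFun g := Multiplicative.ofAdd ((s * g.x + t * g.y : ℤ) : ZMod m)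
  map_one' := by simp
  map_mul' g h := by
    rw [← ofAdd_add, ← Int.cast_add]
    congr 2
    simp only [mul_x, mul_y]
    ring

lemma toZMod_eq_one_iff {m : ℕ} {s t : ℤ} {g : IntHeisenberg} :
    toZMod m s t g = 1 ↔ (m : ℤ) ∣ s * g.x + t * g.y := by
  rw [← ZMod.intCast_zmod_eq_zero_iff_dvd]
  rfl

end IntHeisenberg

open IntHeisenberg in
/-- In a free group of rank at least two, a generating set `{x, y, v}` never satisfies
`v ^ m = [x, y]` with `2 ≤ m`. -/
lemma FreeGroup.pow_ne_commutator_of_closure_eq_top {β : Type*} [Nontrivial β]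
    {v x y : FreeGroup β} (hgen : Subgroup.closure {x, y, v} = ⊤) {m : ℕ} (hm : 2 ≤ m) :
    v ^ m ≠ x⁻¹ * y⁻¹ * x * y := by
  classical
  intro h
  obtain ⟨a, b, hab⟩ := exists_pair_ne β
  set φ : FreeGroup β →* IntHeisenberg :=
    FreeGroup.lift fun i => ⟨if i = a then 1 else 0, if i = b then 1 else 0, 0⟩ with hφ
  have ha : φ (.of a) = ⟨1, 0, 0⟩ := by simp [hφ, hab]
  have hb : φ (.of b) = ⟨0, 1, 0⟩ := by simp [hφ, hab.symm]
  have h' : φ v ^ m = (φ x)⁻¹ * (φ y)⁻¹ * φ x * φ y := by simpa using congrArg φ h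
  have hm0 : m ≠ 0 := by positivity
  have hvx : (φ v).x = 0 := by
    have := congrArg IntHeisenberg.x h'
    rw [pow_x] at this
    simpa [hm0] using this
  have hvy : (φ v).y = 0 := by
    have := congrArg IntHeisenberg.y h'
    rw [pow_y] at this
    simpa [hm0] using this
  have hdet : (m : ℤ) * (φ v).z = (φ x).x * (φ y).y - (φ y).x * (φ x).y := by
    have := congrArg IntHeisenberg.z h'
    rw [pow_z_of_y_eq_zero hvy] at this
    rw [this]
    simp
    ring
  have dvd_of_dvd {s t : ℤ} (hx : (m : ℤ) ∣ s * (φ x).x + t * (φ x).y)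
      (hy : (m : ℤ) ∣ s * (φ y).x + t * (φ y).y) : (m : ℤ) ∣ s ∧ (m : ℤ) ∣ t := by
    have key : (toZMod m s t).comp φ = 1 := by
      refine MonoidHom.eq_of_eqOn_dense hgen ?_
      rintro g (rfl | rfl | rfl) <;>
        simp only [MonoidHom.comp_apply, MonoidHom.one_apply, toZMod_eq_one_iff]
      · exact hx
      · exact hy
      · simp [hvx, hvy]
    have ha' := DFunLike.congr_fun key (.of a)
    have hb' := DFunLike.congr_fun key (.of b)
    rw [MonoidHom.comp_apply, MonoidHom.one_apply, toZMod_eq_one_iff] at ha' hb'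
    exact ⟨by simpa [ha] using ha', by simpa [hb] using hb'⟩
  obtain ⟨-, hxx⟩ := dvd_of_dvd (s := -(φ x).y) (t := (φ x).x) ⟨0, by ring⟩
    ⟨(φ v).z, by rw [hdet]; ring⟩
  obtain ⟨-, hyx⟩ := dvd_of_dvd (s := (φ y).y) (t := -(φ y).x)
    ⟨(φ v).z, by rw [hdet]; ring⟩ ⟨0, by ring⟩
  obtain ⟨h1, -⟩ := dvd_of_dvd (s := 1) (t := 0) (by simpa using hxx) (by simpa using hyx)
  have := Int.le_of_dvd one_pos h1
  omega

lemma FreeGroup.commute_of_subsingleton {β : Type*} [Subsingleton β] (x y : FreeGroup β) :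
    Commute x y := by
  have hcomm : ∀ g ∈ Set.range (FreeGroup.of (α := β)), ∀ h ∈ Set.range (FreeGroup.of (α := β)),
      g * h = h * g := by
    rintro _ ⟨i, rfl⟩ _ ⟨j, rfl⟩
    rw [Subsingleton.elim i j]
  refine Subgroup.closure_induction₂ (p := fun g h _ _ => Commute g h)
    (fun g h hg hh => hcomm g hg h hh)
    (fun g _ => Commute.one_left g) (fun g _ => Commute.one_right g)
    (fun _ _ _ _ _ _ => Commute.mul_left) (fun _ _ _ _ _ _ => Commute.mul_right)
    (fun _ _ _ _ => Commute.inv_left) (fun _ _ _ _ => Commute.inv_right)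
    (FreeGroup.closure_range_of β ▸ Subgroup.mem_top x)
    (FreeGroup.closure_range_of β ▸ Subgroup.mem_top y)

theorem stmt7 {α : Type*} (V X Y : FreeGroup α) (m : ℕ) (hm : 2 ≤ m)
    (h : V ^ m = X⁻¹ * Y⁻¹ * X * Y) : V = 1 := by
  let K : Subgroup (FreeGroup α) := Subgroup.closure {X, Y, V}
  have hK : ({X, Y, V} : Set (FreeGroup α)) ⊆ K := Subgroup.subset_closure
  let x : K := ⟨X, hK (by simp)⟩
  let y : K := ⟨Y, hK (by simp)⟩
  let v : K := ⟨V, hK (by simp)⟩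
  let e : K ≃* FreeGroup (IsFreeGroup.Generators K) := IsFreeGroup.toFreeGroup K
  have hv : v ^ m = x⁻¹ * y⁻¹ * x * y := Subtype.ext h
  have hgen : Subgroup.closure ({x, y, v} : Set K) = ⊤ := by
    have := Subgroup.closure_closure_coe_preimage (k := ({X, Y, V} : Set (FreeGroup α)))
    rw [← this]
    congr 1
    ext ⟨g, hg⟩
    simp [x, y, v]
  have hgen' : Subgroup.closure {e x, e y, e v} = ⊤ := by
    have := congrArg (Subgroup.map e.toMonoidHom) hgen
    rw [MonoidHom.map_closure, Subgroup.map_top_of_surjective _ e.surjective] at this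
    simpa [Set.image_insert_eq] using this
  have hev : e v ^ m = (e x)⁻¹ * (e y)⁻¹ * e x * e y := by simpa using congrArg e hv
  rcases subsingleton_or_nontrivial (IsFreeGroup.Generators K) with hs | hn
  · have hc := FreeGroup.commute_of_subsingleton (e x) (e y)
    have hpow : e v ^ m = 1 := by
      rw [hev, mul_assoc, hc.eq]
      group
    have hv1 : v = 1 := by simpa [show m ≠ 0 by positivity] using hpow
    exact congrArg Subtype.val hv1
  · exact absurd hev (FreeGroup.pow_ne_commutator_of_closure_eq_top hgen' hm)
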